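/- For every 4×4 matrix G with entries in the Gaussian integers Z[i] satisfying Gᴴ J G = J, there exists a unit λ ∈ {1, −1, i, −i} of Z[i] such that λ·G belongs to the subgroup generated by the five matrices N₁, N₂, M₁, M₂, R (i.e. λ·G is a finite product of these matrices and their inverses). In other words, up to the center, the Gauss–Picard modular group U(3,1;Z[i]) is generated by the two Heisenberg translations N₁, N₂, the two Heisenberg rotations M₁, M₂, and the involution R. -/

import Mathlib

open Matrix Complex

/-- A complex number is a Gaussian integer. -/
def IsGaussInt (z : ℂ) : Prop := ∃ a b : ℤ, z = (a : ℂ) + (b : ℂ) * Complex.I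

noncomputable def Jmat : Matrix (Fin 4) (Fin 4) ℂ :=
  !![0,0,0,1; 0,1,0,0; 0,0,1,0; 1,0,0,0]

noncomputable def Nmat₁ : Matrix (Fin 4) (Fin 4) ℂ :=
  !![1,-1,-1,-1; 0,1,0,1; 0,0,1,1; 0,0,0,1]

noncomputable def Nmat₂ : Matrix (Fin 4) (Fin 4) ℂ :=
  !![1,0,0,Complex.I; 0,1,0,0; 0,0,1,0; 0,0,0,1]

noncomputable def Mmat₁ : Matrix (Fin 4) (Fin 4) ℂ :=
  !![1,0,0,0; 0,0,1,0; 0,1,0,0; 0,0,0,1]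

noncomputable def Mmat₂ : Matrix (Fin 4) (Fin 4) ℂ :=
  !![1,0,0,0; 0,Complex.I,0,0; 0,0,1,0; 0,0,0,1]

noncomputable def Rmat : Matrix (Fin 4) (Fin 4) ℂ :=
  !![0,0,0,1; 0,-1,0,0; 0,0,-1,0; 1,0,0,0]

/-- membership of a matrix in the generated subgroup -/
def PP (A : Matrix (Fin 4) (Fin 4) ℂ) : Prop :=
  ∃ g ∈ Subgroup.closure
        {g : GL (Fin 4) ℂ | (g : Matrix (Fin 4) (Fin 4) ℂ) = Nmat₁ ∨
          (g : Matrix (Fin 4) (Fin 4) ℂ) = Nmat₂ ∨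
          (g : Matrix (Fin 4) (Fin 4) ℂ) = Mmat₁ ∨
          (g : Matrix (Fin 4) (Fin 4) ℂ) = Mmat₂ ∨
          (g : Matrix (Fin 4) (Fin 4) ℂ) = Rmat}, (g : Matrix (Fin 4) (Fin 4) ℂ) = A

def IsU (l : ℂ) : Prop := l = 1 ∨ l = -1 ∨ l = Complex.I ∨ l = -Complex.I

def GoodM (A : Matrix (Fin 4) (Fin 4) ℂ) : Prop := ∃ lam : ℂ, IsU lam ∧ PP (lam • A)

lemma PP_one : PP 1 := ⟨1, Subgroup.one_mem _, rfl⟩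

lemma PP_mul {A B} (hA : PP A) (hB : PP B) : PP (A * B) := by
  obtain ⟨g, hg, rfl⟩ := hA
  obtain ⟨h, hh, rfl⟩ := hB
  exact ⟨g * h, Subgroup.mul_mem _ hg hh, rfl⟩

lemma PP_inv {A B} (hA : PP A) (h : A * B = 1) : PP B := by
  obtain ⟨g, hg, rfl⟩ := hA
  refine ⟨g⁻¹, Subgroup.inv_mem _ hg, ?_⟩
  have h2 : ((g⁻¹ : GL (Fin 4) ℂ) : Matrix (Fin 4) (Fin 4) ℂ) * (g : Matrix (Fin 4) (Fin 4) ℂ) = 1 :=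
    g.inv_mul
  calc ((g⁻¹ : GL (Fin 4) ℂ) : Matrix (Fin 4) (Fin 4) ℂ)
      = ((g⁻¹ : GL (Fin 4) ℂ) : Matrix (Fin 4) (Fin 4) ℂ) * ((g : Matrix (Fin 4) (Fin 4) ℂ) * B) := by
        rw [h, mul_one]
    _ = B := by rw [← mul_assoc, h2, one_mul]

lemma PP_cancel {A B} (hA : PP A) (h : PP (A * B)) : PP B := by
  obtain ⟨g, hg, rfl⟩ := hA
  obtain ⟨k, hk, hkk⟩ := h
  refine ⟨g⁻¹ * k, Subgroup.mul_mem _ (Subgroup.inv_mem _ hg) hk, ?_⟩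
  have h2 : ((g⁻¹ : GL (Fin 4) ℂ) : Matrix (Fin 4) (Fin 4) ℂ) * (g : Matrix (Fin 4) (Fin 4) ℂ) = 1 :=
    g.inv_mul
  rw [Units.val_mul, hkk, ← mul_assoc, h2, one_mul]

lemma Good_cancel {A B} (hA : PP A) (h : GoodM (A * B)) : GoodM B := by
  obtain ⟨l, hl, h⟩ := h
  refine ⟨l, hl, PP_cancel hA ?_⟩
  rwa [Matrix.mul_smul]

lemma PP_gen {A : Matrix (Fin 4) (Fin 4) ℂ} (B : Matrix (Fin 4) (Fin 4) ℂ) (h : A * B = 1)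
    (hA : A = Nmat₁ ∨ A = Nmat₂ ∨ A = Mmat₁ ∨ A = Mmat₂ ∨ A = Rmat) : PP A :=
  ⟨⟨A, B, h, mul_eq_one_comm.mp h⟩, Subgroup.subset_closure hA, rfl⟩

def TT (z w q : ℂ) : Matrix (Fin 4) (Fin 4) ℂ :=
  !![1, -star z, -star w, q; 0,1,0,z; 0,0,1,w; 0,0,0,1]

lemma TT_mul (z w q z' w' q' : ℂ) : TT z w q * TT z' w' q' =
    TT (z+z') (w+w') (q+q' - star z * z' - star w * w') := by
  ext i j
  fin_cases i <;> fin_cases j <;> simp [TT, Matrix.mul_apply, Fin.sum_univ_four] <;> ring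

lemma TT_one : TT 0 0 0 = 1 := by
  ext i j
  fin_cases i <;> fin_cases j <;> simp [TT]

def DD (a b c d : ℂ) : Matrix (Fin 4) (Fin 4) ℂ :=
  !![1,0,0,0; 0,a,b,0; 0,c,d,0; 0,0,0,1]

lemma DD_mul (a b c d a' b' c' d' : ℂ) : DD a b c d * DD a' b' c' d' =
    DD (a*a'+b*c') (a*b'+b*d') (c*a'+d*c') (c*b'+d*d') := by
  ext i j
  fin_cases i <;> fin_cases j <;> simp [DD, Matrix.mul_apply, Fin.sum_univ_four]

lemma DD_one : DD 1 0 0 1 = 1 := by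
  ext i j
  fin_cases i <;> fin_cases j <;> simp [DD]

lemma PP_R : PP Rmat := by
  refine PP_gen Rmat ?_ (by simp)
  ext i j
  fin_cases i <;> fin_cases j <;> simp [Rmat, Matrix.mul_apply, Fin.sum_univ_four]

lemma PP_N1 : PP (TT 1 1 (-1)) := by
  refine PP_gen (TT (-1) (-1) (-1)) ?_ (Or.inl ?_)
  · rw [TT_mul, ← TT_one]; congr 1 <;> simp
  · simp [TT, Nmat₁]

lemma PP_N2 : PP (TT 0 0 I) := by
  refine PP_gen (TT 0 0 (-I)) ?_ (Or.inr (Or.inl ?_))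
  · rw [TT_mul, ← TT_one]; congr 1 <;> simp
  · simp [TT, Nmat₂]

lemma PP_M1 : PP (DD 0 1 1 0) := by
  refine PP_gen (DD 0 1 1 0) ?_ (Or.inr (Or.inr (Or.inl ?_)))
  · rw [DD_mul, ← DD_one]; congr 1 <;> simp
  · simp [DD, Mmat₁]

lemma PP_M2 : PP (DD I 0 0 1) := by
  refine PP_gen (DD (-I) 0 0 1) ?_ (Or.inr (Or.inr (Or.inr (Or.inl ?_))))
  · rw [DD_mul, ← DD_one]; congr 1 <;> simp
  · simp [DD, Mmat₂]

lemma PP_diag1 {u : ℂ} (hu : IsU u) : PP (DD u 0 0 1) := by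
  have h2 : PP (DD (-1) 0 0 1) := by simpa [DD_mul] using PP_mul PP_M2 PP_M2
  rcases hu with rfl | rfl | rfl | rfl
  · rw [DD_one]; exact PP_one
  · exact h2
  · exact PP_M2
  · simpa [DD_mul] using PP_mul h2 PP_M2

lemma PP_diag {u v : ℂ} (hu : IsU u) (hv : IsU v) : PP (DD u 0 0 v) := by
  simpa [DD_mul] using PP_mul (PP_diag1 hu) (PP_mul PP_M1 (PP_mul (PP_diag1 hv) PP_M1))

lemma PP_anti {u v : ℂ} (hu : IsU u) (hv : IsU v) : PP (DD 0 u v 0) := by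
  simpa [DD_mul] using PP_mul (PP_diag hu hv) PP_M1

lemma PP_N2z (k : ℤ) : PP (TT 0 0 (k * I)) := by
  have hs : ∀ n : ℕ, PP (TT 0 0 (n * I)) := by
    intro n
    induction n with
    | zero => simpa [TT_one] using PP_one
    | succ n ih =>
      have := PP_mul ih PP_N2
      rw [TT_mul] at this
      convert this using 2 <;> simp
      ring
  obtain ⟨n, rfl | rfl⟩ := k.eq_nat_or_neg
  · simpa using hs n
  · refine PP_inv (hs n) ?_
    rw [TT_mul, ← TT_one]; congr 1 <;> simp

lemma gi_add {a b : ℂ} : IsGaussInt a → IsGaussInt b → IsGaussInt (a + b) := by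
  rintro ⟨x, y, rfl⟩ ⟨x', y', rfl⟩
  exact ⟨x + x', y + y', by push_cast; ring⟩

lemma gi_mul {a b : ℂ} : IsGaussInt a → IsGaussInt b → IsGaussInt (a * b) := by
  rintro ⟨x, y, rfl⟩ ⟨x', y', rfl⟩
  exact ⟨x * x' - y * y', x * y' + y * x', by push_cast; linear_combination (y * y' : ℂ) * I_mul_I⟩

lemma gi_neg {a : ℂ} : IsGaussInt a → IsGaussInt (-a) := by
  rintro ⟨x, y, rfl⟩
  exact ⟨-x, -y, by push_cast; ring⟩

lemma gi_star {a : ℂ} : IsGaussInt a → IsGaussInt (star a) := by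
  rintro ⟨x, y, rfl⟩
  exact ⟨x, -y, by simp⟩

lemma gi_zero : IsGaussInt 0 := ⟨0, 0, by simp⟩
lemma gi_one : IsGaussInt 1 := ⟨1, 0, by simp⟩
lemma gi_I : IsGaussInt I := ⟨0, 1, by simp⟩
lemma gi_U {u : ℂ} (h : IsU u) : IsGaussInt u := by
  rcases h with rfl | rfl | rfl | rfl
  exacts [gi_one, gi_neg gi_one, gi_I, gi_neg gi_I]

lemma gi_matmul {A B : Matrix (Fin 4) (Fin 4) ℂ} (hA : ∀ j k, IsGaussInt (A j k))
    (hB : ∀ j k, IsGaussInt (B j k)) : ∀ j k, IsGaussInt ((A * B) j k) := by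
  intro j k
  rw [Matrix.mul_apply, Fin.sum_univ_four]
  exact gi_add (gi_add (gi_add (gi_mul (hA _ _) (hB _ _)) (gi_mul (hA _ _) (hB _ _)))
    (gi_mul (hA _ _) (hB _ _))) (gi_mul (hA _ _) (hB _ _))

def Lam : AddSubgroup (ℂ × ℂ) where
  carrier := {p | IsGaussInt p.1 ∧ IsGaussInt p.2 ∧ ∃ q, IsGaussInt q ∧ PP (TT p.1 p.2 q) ∧
    q + star q + star p.1 * p.1 + star p.2 * p.2 = 0}
  zero_mem' := ⟨gi_zero, gi_zero, 0, gi_zero, by simpa [TT_one] using PP_one, by simp⟩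
  add_mem' := by
    rintro ⟨z, w⟩ ⟨z', w'⟩ ⟨hz, hw, q, hq, hP, he⟩ ⟨hz', hw', q', hq', hP', he'⟩
    refine ⟨gi_add hz hz', gi_add hw hw', q + q' - star z * z' - star w * w', ?_, ?_, ?_⟩
    rotate_left
    · have := PP_mul hP hP'
      rw [TT_mul] at this
      exact this
    · simp only [Prod.fst_add, Prod.snd_add, star_add, star_sub, star_mul', star_star] at *
      linear_combination he + he'
    · simp only [sub_eq_add_neg]
      exact gi_add (gi_add (gi_add hq hq') (gi_neg (gi_mul (gi_star hz) hz')))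
        (gi_neg (gi_mul (gi_star hw) hw'))
  neg_mem' := by
    rintro ⟨z, w⟩ ⟨hz, hw, q, hq, hP, he⟩
    refine ⟨gi_neg hz, gi_neg hw, star q, gi_star hq, PP_inv hP ?_, ?_⟩
    · rw [TT_mul, ← TT_one]
      simp only [Prod.fst_neg, Prod.snd_neg] at *
      congr 1
      · ring
      · ring
      · linear_combination he
    · simp only [Prod.fst_neg, Prod.snd_neg, star_neg, star_star] at *
      linear_combination he

lemma IsU_star {u : ℂ} (h : IsU u) : star u * u = 1 ∧ IsU (star u) := by
  rcases h with rfl | rfl | rfl | rfl <;> simp [IsU]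

lemma Lam_units {u v : ℂ} (hu : IsU u) (hv : IsU v) : (u, v) ∈ Lam := by
  refine ⟨gi_U hu, gi_U hv, -1, gi_neg gi_one, ?_, ?_⟩
  · have h := PP_mul (PP_mul (PP_diag hu hv) PP_N1) (PP_diag (IsU_star hu).2 (IsU_star hv).2)
    convert h using 1
    have h1 := (IsU_star hu).1
    have h2 := (IsU_star hv).1
    rw [mul_comm] at h1 h2
    simp only [Complex.star_def] at h1 h2
    ext i j
    fin_cases i <;> fin_cases j <;>
      simp [TT, DD, Matrix.mul_apply, Fin.sum_univ_four, h1, h2]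
  · have h1 := (IsU_star hu).1
    have h2 := (IsU_star hv).1
    simp only [star_neg, star_one]
    linear_combination h1 + h2

lemma Lam_all (a b c d : ℤ) (h : Even (a + b + c + d)) :
    ((a : ℂ) + b * I, (c : ℂ) + d * I) ∈ Lam := by
  obtain ⟨p, hp⟩ := h
  have e1 : ((1 : ℂ), (1 : ℂ)) ∈ Lam := Lam_units (by simp [IsU]) (by simp [IsU])
  have e2 : ((1 : ℂ), (-1 : ℂ)) ∈ Lam := Lam_units (by simp [IsU]) (by simp [IsU])
  have e3 : (I, (1 : ℂ)) ∈ Lam := Lam_units (by simp [IsU]) (by simp [IsU])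
  have e4 : ((1 : ℂ), I) ∈ Lam := Lam_units (by simp [IsU]) (by simp [IsU])
  have := Lam.add_mem (Lam.add_mem (Lam.zsmul_mem e1 (p - b - d)) (Lam.zsmul_mem e2 (p - d - c)))
    (Lam.add_mem (Lam.zsmul_mem e3 b) (Lam.zsmul_mem e4 d))
  have hp' : (a : ℂ) + b + c + d = p + p := by exact_mod_cast congrArg (Int.cast : ℤ → ℂ) hp
  convert this using 1
  ext1
  · simp
    linear_combination hp'
  · simp
    ring

/-- all integral Heisenberg translations -/
lemma TT_all {z w q : ℂ} (hz : IsGaussInt z) (hw : IsGaussInt w) (hq : IsGaussInt q)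
    (he : q + star q + star z * z + star w * w = 0) : PP (TT z w q) := by
  obtain ⟨a, b, rfl⟩ := hz
  obtain ⟨c, d, rfl⟩ := hw
  obtain ⟨x, y, rfl⟩ := hq
  have hr : 2 * x + (a^2+b^2) + (c^2+d^2) = 0 := by
    have := congrArg Complex.re he
    simp at this
    have h2 : (2 * x + (a^2+b^2) + (c^2+d^2) : ℝ) = 0 := by linear_combination this
    exact_mod_cast h2
  have hev : Even (a + b + c + d) := by
    have h1 : Even ((a^2+b^2) + (c^2+d^2)) := ⟨-x, by linarith⟩
    simpa [Int.even_add, Int.even_pow, ← add_assoc] using h1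
  obtain ⟨-, -, q, ⟨x', y', rfl⟩, hP, he'⟩ := Lam_all a b c d hev
  have hr' : 2 * x' + (a^2+b^2) + (c^2+d^2) = 0 := by
    have := congrArg Complex.re he'
    simp at this
    have h2 : (2 * x' + (a^2+b^2) + (c^2+d^2) : ℝ) = 0 := by linear_combination this
    exact_mod_cast h2
  have hx : x' = x := by omega
  subst hx
  have := PP_mul hP (PP_N2z (y - y'))
  rw [TT_mul] at this
  convert this using 2
  · simp
  · simp
  · simp
    ring

lemma TT_unit {z w q : ℂ} (he : q + star q + star z * z + star w * w = 0) :
    (TT z w q)ᴴ * Jmat * TT z w q = Jmat := by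
  simp only [Complex.star_def] at he
  ext i j
  fin_cases i <;> fin_cases j <;>
    simp [TT, Jmat, Matrix.mul_apply, Fin.sum_univ_four]
  linear_combination he

lemma R_unit : Rmatᴴ * Jmat * Rmat = Jmat := by
  ext i j
  fin_cases i <;> fin_cases j <;>
    simp [Rmat, Jmat, Matrix.mul_apply, Fin.sum_univ_four]

lemma unit_mul {A B : Matrix (Fin 4) (Fin 4) ℂ} (hA : Aᴴ * Jmat * A = Jmat)
    (hB : Bᴴ * Jmat * B = Jmat) : (A * B)ᴴ * Jmat * (A * B) = Jmat := by
  rw [Matrix.conjTranspose_mul]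
  calc _ = Bᴴ * (Aᴴ * Jmat * A) * B := by simp only [Matrix.mul_assoc]
    _ = _ := by rw [hA, hB]

lemma gi_TT {z w q : ℂ} (hz : IsGaussInt z) (hw : IsGaussInt w) (hq : IsGaussInt q) :
    ∀ j k, IsGaussInt (TT z w q j k) := by
  intro j k
  fin_cases j <;> fin_cases k <;> simp [TT] <;>
    first | exact gi_zero | exact gi_one | assumption | exact gi_neg (gi_star ‹_›)

lemma gi_R : ∀ j k, IsGaussInt (Rmat j k) := by
  intro j k
  fin_cases j <;> fin_cases k <;> simp [Rmat] <;>
    first | exact gi_zero | exact gi_one | exact gi_neg gi_one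

/-- Hermitian form relation between columns -/
lemma cols {G : Matrix (Fin 4) (Fin 4) ℂ} (hG : Gᴴ * Jmat * G = Jmat) (j k : Fin 4) :
    star (G 3 j) * G 0 k + star (G 1 j) * G 1 k + star (G 2 j) * G 2 k + star (G 0 j) * G 3 k
      = Jmat j k := by
  rw [← hG]
  simp [Matrix.mul_apply, Fin.sum_univ_four, Jmat]

lemma sq_cases {a b c d : ℤ} (h : a^2+b^2+(c^2+d^2) = 1) :
    (a^2+b^2=1 ∧ c = 0 ∧ d = 0) ∨ (a = 0 ∧ b = 0 ∧ c^2+d^2=1) := by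
  by_cases h1 : a^2+b^2 = 0
  · right
    have ha : a = 0 := by nlinarith [sq_nonneg a, sq_nonneg b]
    have hb : b = 0 := by nlinarith [sq_nonneg a, sq_nonneg b]
    exact ⟨ha, hb, by linarith⟩
  · left
    have : 0 < a^2+b^2 := lt_of_le_of_ne (by positivity) (Ne.symm h1)
    have hc : c = 0 := by nlinarith [sq_nonneg c, sq_nonneg d]
    have hd : d = 0 := by nlinarith [sq_nonneg c, sq_nonneg d]
    subst hc hd
    exact ⟨by linarith, rfl, rfl⟩

lemma isU_of {a b : ℤ} (h : a^2+b^2=1) : IsU ((a:ℂ) + b * I) := by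
  have h' : a^2+0^2+(b^2+0^2) = 1 := by linarith
  rcases sq_cases h' with ⟨h1, rfl, -⟩ | ⟨rfl, -, h1⟩
  · have : a = 1 ∨ a = -1 := by
      apply sq_eq_sq_iff_eq_or_eq_neg.mp; linarith
    rcases this with rfl | rfl <;> simp [IsU]
  · have : b = 1 ∨ b = -1 := by
      apply sq_eq_sq_iff_eq_or_eq_neg.mp; linarith
    rcases this with rfl | rfl <;> simp [IsU]

lemma gi_normSq {z : ℂ} (hz : IsGaussInt z) : ∃ n : ℕ, Complex.normSq z = n := by
  obtain ⟨a, b, rfl⟩ := hz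
  refine ⟨(a^2+b^2).toNat, ?_⟩
  have : (((a^2+b^2).toNat : ℤ) : ℝ) = ((a^2+b^2 : ℤ) : ℝ) := by
    rw [Int.toNat_of_nonneg (by positivity)]
  have h2 : (((a^2+b^2).toNat : ℕ) : ℝ) = ((a^2+b^2 : ℤ) : ℝ) := by exact_mod_cast this
  rw [h2]
  simp [Complex.normSq_apply]
  ring

lemma isU_of_normSq {z : ℂ} (hz : IsGaussInt z) (h : Complex.normSq z = 1) : IsU z := by
  obtain ⟨a, b, rfl⟩ := hz
  apply isU_of
  simp [Complex.normSq_apply] at h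
  have : (a^2+b^2 : ℝ) = 1 := by linarith
  exact_mod_cast this

lemma star_mul_normSq (z : ℂ) : star z * z = (Complex.normSq z : ℂ) := by
  rw [Complex.normSq_eq_conj_mul_self]; rfl

lemma pair_cases {z w : ℂ} (hz : IsGaussInt z) (hw : IsGaussInt w)
    (h : star z * z + star w * w = 1) : (IsU z ∧ w = 0) ∨ (z = 0 ∧ IsU w) := by
  simp only [star_mul_normSq] at h
  have h' : Complex.normSq z + Complex.normSq w = 1 := by exact_mod_cast h
  obtain ⟨n, hn⟩ := gi_normSq hz
  obtain ⟨m, hm⟩ := gi_normSq hw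
  have hnm : n + m = 1 := by rw [hn, hm] at h'; exact_mod_cast h'
  have : (n = 1 ∧ m = 0) ∨ (n = 0 ∧ m = 1) := by omega
  rcases this with ⟨rfl, rfl⟩ | ⟨rfl, rfl⟩
  · left
    exact ⟨isU_of_normSq hz (by simpa using hn), Complex.normSq_eq_zero.mp (by simpa using hm)⟩
  · right
    exact ⟨Complex.normSq_eq_zero.mp (by simpa using hn), isU_of_normSq hw (by simpa using hm)⟩

lemma isU_ne {u : ℂ} (h : IsU u) : star u ≠ 0 := by
  intro h0
  have := (IsU_star h).1
  rw [h0] at this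
  simp at this

lemma PP_DD {a b c d : ℂ} (ha : IsGaussInt a) (hb : IsGaussInt b) (hc : IsGaussInt c)
    (hd : IsGaussInt d) (h1 : star a * a + star c * c = 1) (h2 : star b * b + star d * d = 1)
    (h3 : star a * b + star c * d = 0) : PP (DD a b c d) := by
  rcases pair_cases ha hc h1 with ⟨hu, rfl⟩ | ⟨rfl, hu⟩
  · have : b = 0 := (mul_eq_zero.mp (by simpa using h3)).resolve_left (isU_ne hu)
    subst this
    rcases pair_cases hb hd h2 with ⟨hv, -⟩ | ⟨-, hv⟩
    · exact absurd (star_zero ℂ) (isU_ne hv)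
    · exact PP_diag hu hv
  · have : d = 0 := (mul_eq_zero.mp (by simpa using h3)).resolve_left (isU_ne hu)
    subst this
    rcases pair_cases hb hd h2 with ⟨hv, -⟩ | ⟨-, hv⟩
    · exact PP_anti hv hu
    · exact absurd (star_zero ℂ) (isU_ne hv)

lemma base1 {G : Matrix (Fin 4) (Fin 4) ℂ} (hG : Gᴴ * Jmat * G = Jmat)
    (hint : ∀ j k, IsGaussInt (G j k)) (h0 : G 0 0 = 1) (h1 : G 1 0 = 0) (h2 : G 2 0 = 0)
    (h3 : G 3 0 = 0) : PP G := by
  have c := cols hG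
  have h31 : G 3 1 = 0 := by simpa [h0, h1, h2, h3, Jmat] using c 0 1
  have h32 : G 3 2 = 0 := by simpa [h0, h1, h2, h3, Jmat] using c 0 2
  have h33 : G 3 3 = 1 := by simpa [h0, h1, h2, h3, Jmat] using c 0 3
  have c11 := c 1 1
  have c22 := c 2 2
  have c12 := c 1 2
  have c31 := c 3 1
  have c32 := c 3 2
  have c33 := c 3 3
  simp [h31, h32, h33, Jmat, -Complex.star_def, -RCLike.star_def] at c11 c22 c12 c31 c32 c33
  have hD := PP_DD (hint 1 1) (hint 1 2) (hint 2 1) (hint 2 2) c11 c22 c12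
  have hT : PP (TT (G 1 3) (G 2 3) (G 0 3)) :=
    TT_all (hint _ _) (hint _ _) (hint _ _) (by linear_combination c33)
  convert PP_mul hT hD using 1
  simp only [Complex.star_def] at c31 c32
  ext i j
  fin_cases i <;> fin_cases j <;>
    simp [TT, DD, Matrix.mul_apply, Fin.sum_univ_four, h0, h1, h2, h3, h31, h32, h33]
  · linear_combination c31
  · linear_combination c32

lemma base0 {G : Matrix (Fin 4) (Fin 4) ℂ} (hG : Gᴴ * Jmat * G = Jmat)
    (hint : ∀ j k, IsGaussInt (G j k)) (h3 : G 3 0 = 0) : GoodM G := by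
  have c := cols hG
  have c00 := c 0 0
  simp [h3, Jmat, -Complex.star_def, -RCLike.star_def] at c00
  simp only [star_mul_normSq] at c00
  have c00' : Complex.normSq (G 1 0) + Complex.normSq (G 2 0) = 0 := by exact_mod_cast c00
  have h1 : G 1 0 = 0 := Complex.normSq_eq_zero.mp
    (by linarith [Complex.normSq_nonneg (G 1 0), Complex.normSq_nonneg (G 2 0)])
  have h2 : G 2 0 = 0 := Complex.normSq_eq_zero.mp
    (by linarith [Complex.normSq_nonneg (G 1 0), Complex.normSq_nonneg (G 2 0)])
  have c03 := c 0 3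
  simp [h1, h2, h3, Jmat, -Complex.star_def, -RCLike.star_def] at c03
  have hn := congrArg Complex.normSq c03
  rw [Complex.normSq_mul, Complex.star_def, Complex.normSq_conj, Complex.normSq_one] at hn
  obtain ⟨n, hn'⟩ := gi_normSq (hint 0 0)
  obtain ⟨m, hm'⟩ := gi_normSq (hint 3 3)
  rw [hn', hm'] at hn
  have hnm : n * m = 1 := by exact_mod_cast hn
  have hn1 : n = 1 := Nat.eq_one_of_mul_eq_one_right hnm
  have hu : IsU (G 0 0) := isU_of_normSq (hint 0 0) (by rw [hn', hn1]; simp)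
  obtain ⟨hs, hsU⟩ := IsU_star hu
  refine ⟨star (G 0 0), hsU, base1 ?_ ?_ ?_ ?_ ?_ ?_⟩
  · rw [Matrix.conjTranspose_smul, star_star, Matrix.smul_mul, Matrix.smul_mul, Matrix.mul_smul,
      smul_smul, hG, mul_comm, hs, one_smul]
  · intro j k
    exact gi_mul (gi_star (hint _ _)) (hint _ _)
  · exact hs
  · simp [h1]
  · simp [h2]
  · simp [h3]

/-- covering radius of the D4 lattice -/
lemma cover_aux (x y z w : ℝ) (a b c d : ℤ) (h : |x - a| ≤ 1/2)
    (hy : |y - b| ≤ |x - a|) (hz : |z - c| ≤ |x - a|) (hw : |w - d| ≤ |x - a|) :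
    ∃ a' : ℤ, Even (a' + b + c + d) ∧
      (x - a')^2 + (y-b)^2 + (z-c)^2+(w-d)^2 ≤ 1 := by
  have e1 := sq_le_sq.mpr (by simpa using hy)
  have e2 := sq_le_sq.mpr (by simpa using hz)
  have e3 := sq_le_sq.mpr (by simpa using hw)
  have e0 : (x - a)^2 = |x-a|^2 := (sq_abs _).symm
  have hn := abs_nonneg (x - a)
  rcases Int.even_or_odd (a + b + c + d) with he | ho
  · refine ⟨a, he, ?_⟩
    nlinarith
  · rcases le_total 0 (x - a) with hp | hp
    · refine ⟨a + 1, ?_, ?_⟩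
      · obtain ⟨t, ht⟩ := ho
        exact ⟨t + 1, by omega⟩
      · rw [abs_of_nonneg hp] at *
        push_cast
        nlinarith
    · refine ⟨a - 1, ?_, ?_⟩
      · obtain ⟨t, ht⟩ := ho
        exact ⟨t, by omega⟩
      · rw [abs_of_nonpos hp] at *
        push_cast
        nlinarith

lemma cover (x y z w : ℝ) : ∃ a b c d : ℤ, Even (a + b + c + d) ∧
      (x - a)^2 + (y-b)^2 + (z-c)^2+(w-d)^2 ≤ 1 := by
  have hx := abs_sub_round x
  have hy := abs_sub_round y
  have hz := abs_sub_round z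
  have hw := abs_sub_round w
  have key : ∀ p q r s : ℝ, (q ≤ p ∧ r ≤ p ∧ s ≤ p) ∨ (p ≤ q ∧ r ≤ q ∧ s ≤ q) ∨
      (p ≤ r ∧ q ≤ r ∧ s ≤ r) ∨ (p ≤ s ∧ q ≤ s ∧ r ≤ s) := by
    intro p q r s
    grind
  rcases key |x - round x| |y - round y| |z - round z| |w - round w| with
    ⟨h1, h2, h3⟩ | ⟨h1, h2, h3⟩ | ⟨h1, h2, h3⟩ | ⟨h1, h2, h3⟩
  · obtain ⟨a, ha, hb⟩ := cover_aux x y z w _ _ _ _ hx h1 h2 h3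
    exact ⟨a, _, _, _, ha, hb⟩
  · obtain ⟨a, ha, hb⟩ := cover_aux y x z w _ _ _ _ hy h1 h2 h3
    exact ⟨round x, a, round z, round w, by convert ha using 1; ring, by linarith⟩
  · obtain ⟨a, ha, hb⟩ := cover_aux z x y w _ _ _ _ hz h1 h2 h3
    exact ⟨round x, round y, a, round w, by convert ha using 1; ring, by linarith⟩
  · obtain ⟨a, ha, hb⟩ := cover_aux w x y z _ _ _ _ hw h1 h2 h3
    exact ⟨round x, round y, round z, a, by convert ha using 1; ring, by linarith⟩

lemma translate_iso {x0 x1 x2 x3 z w q : ℂ}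
    (hiso : star x3 * x0 + star x1 * x1 + star x2 * x2 + star x0 * x3 = 0)
    (he : q + star q + star z * z + star w * w = 0) :
    star x3 * (x0 - star z * x1 - star w * x2 + q * x3) + star (x1 + z * x3) * (x1 + z * x3)
      + star (x2 + w * x3) * (x2 + w * x3) + star (x0 - star z * x1 - star w * x2 + q * x3) * x3
      = 0 := by
  simp only [star_add, star_sub, star_mul', star_star]
  linear_combination hiso + star x3 * x3 * he

lemma reduce {x0 x1 x2 x3 : ℂ}
    (hiso : star x3 * x0 + star x1 * x1 + star x2 * x2 + star x0 * x3 = 0) (h3 : x3 ≠ 0) :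
    ∃ z w q : ℂ, IsGaussInt z ∧ IsGaussInt w ∧ IsGaussInt q ∧
      q + star q + star z * z + star w * w = 0 ∧
      Complex.normSq (x0 - star z * x1 - star w * x2 + q * x3) < Complex.normSq x3 := by
  obtain ⟨a, b, c, d, hev, hle⟩ := cover (-(x1/x3)).re (-(x1/x3)).im (-(x2/x3)).re (-(x2/x3)).im
  have hev' : Even (a^2+b^2+c^2+d^2) := by
    simpa [Int.even_add, Int.even_pow] using hev
  obtain ⟨m, hm⟩ := hev'
  set z : ℂ := a + b * I with hz
  set w : ℂ := c + d * I with hw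
  have hm' : (a:ℂ)^2+b^2+c^2+d^2 = m + m := by exact_mod_cast congrArg (Int.cast : ℤ → ℂ) hm
  have hzz : star z * z = a^2+b^2 := by
    simp [hz]; linear_combination (-(b:ℂ)^2) * I_sq
  have hww : star w * w = c^2+d^2 := by
    simp [hw]; linear_combination (-(d:ℂ)^2) * I_sq
  set p : ℂ := (x0 - star z * x1 - star w * x2 - m * x3) / x3 with hp
  have heq : ∀ k : ℤ, ((-m : ℤ) + (k : ℤ) * I : ℂ) + star ((-m : ℤ) + (k : ℤ) * I : ℂ)
      + star z * z + star w * w = 0 := by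
    intro k
    rw [hzz, hww]
    simp
    linear_combination hm'
  refine ⟨z, w, (-m : ℤ) + (-round p.im : ℤ) * I, ⟨_, _, rfl⟩, ⟨_, _, rfl⟩, ⟨_, _, rfl⟩, heq _, ?_⟩
  have hiso' := translate_iso hiso (heq (-round p.im))
  set Y : ℂ := x0 - star z * x1 - star w * x2 + ((-m : ℤ) + (-round p.im : ℤ) * I) * x3 with hY
  have hYp : Y = (p - round p.im * I) * x3 := by
    rw [hY, hp]; field_simp; push_cast; ring
  have hN3 : 0 < Complex.normSq x3 := Complex.normSq_pos.mpr h3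
  have hz1 : x1 + z * x3 = (x1 / x3 + z) * x3 := by field_simp
  have hw1 : x2 + w * x3 = (x2 / x3 + w) * x3 := by field_simp
  set P : ℂ := p - round p.im * I with hP
  have hs3 : star x3 ≠ 0 := by simpa using h3
  have hrel : P + star P + star (x1 / x3 + z) * (x1 / x3 + z) + star (x2 / x3 + w) * (x2 / x3 + w)
      = 0 := by
    rw [hYp, hz1, hw1] at hiso'
    simp only [star_mul'] at hiso'
    have : star x3 * x3 * (P + star P + star (x1 / x3 + z) * (x1 / x3 + z)
        + star (x2 / x3 + w) * (x2 / x3 + w)) = 0 := by linear_combination hiso'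
    exact (mul_eq_zero.mp this).resolve_left (mul_ne_zero hs3 h3)
  rw [star_mul_normSq, star_mul_normSq] at hrel
  have hre := congrArg Complex.re hrel
  simp only [Complex.add_re, Complex.star_def, Complex.conj_re, Complex.ofReal_re,
    Complex.zero_re, Complex.normSq_apply] at hre
  have z1 : (x1 / x3 + z).re = (x1/x3).re + a := by simp [hz]
  have z2 : (x1 / x3 + z).im = (x1/x3).im + b := by simp [hz]
  have z3 : (x2 / x3 + w).re = (x2/x3).re + c := by simp [hw]
  have z4 : (x2 / x3 + w).im = (x2/x3).im + d := by simp [hw]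
  simp only [Complex.add_re, Complex.add_im] at z1 z2 z3 z4 hre
  simp only [z1, z2, z3, z4] at hre
  simp only [Complex.neg_re, Complex.neg_im] at hle
  have hPim : |P.im| ≤ 1/2 := by
    have : P.im = p.im - round p.im := by simp [hP]
    rw [this]; exact abs_sub_round _
  rw [hYp, Complex.normSq_mul]
  have hPN : Complex.normSq P < 1 := by
    rw [Complex.normSq_apply]
    have h1 : P.re ≤ 0 := by nlinarith [sq_nonneg ((x1/x3).re + a), sq_nonneg ((x1/x3).im + b), sq_nonneg ((x2/x3).re + c), sq_nonneg ((x2/x3).im + d)]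
    have h2 : -(1/2) ≤ P.re := by linarith
    obtain ⟨h5, h6⟩ := abs_le.mp hPim
    nlinarith
  nlinarith

lemma main_ind (n : ℕ) : ∀ G : Matrix (Fin 4) (Fin 4) ℂ, Gᴴ * Jmat * G = Jmat →
    (∀ j k, IsGaussInt (G j k)) → Complex.normSq (G 3 0) = n → GoodM G := by
  induction n using Nat.strong_induction_on with
  | _ n ih =>
    intro G hG hint hn
    by_cases h3 : G 3 0 = 0
    · exact base0 hG hint h3
    have c00 := cols hG 0 0
    obtain ⟨z, w, q, hz, hw, hq, he, hlt⟩ := reduce (by simpa [Jmat] using c00) h3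
    have hT := TT_all hz hw hq he
    refine Good_cancel hT (Good_cancel PP_R ?_)
    have hint' := gi_matmul gi_R (gi_matmul (gi_TT hz hw hq) hint)
    obtain ⟨m, hm⟩ := gi_normSq (hint' 3 0)
    refine ih m ?_ _ (unit_mul R_unit (unit_mul (TT_unit he) hG)) hint' hm
    have hent : (Rmat * (TT z w q * G)) 3 0
        = G 0 0 - star z * G 1 0 - star w * G 2 0 + q * G 3 0 := by
      simp [Rmat, TT, Matrix.mul_apply, Fin.sum_univ_four, Matrix.vecMul, dotProduct]
      ring
    rw [hent] at hm
    rw [hm, hn] at hlt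
    exact_mod_cast hlt

/-- The Gauss–Picard modular group `U(3,1; ℤ[i])` is generated, up to the center,
by the two Heisenberg translations `N₁, N₂`, the two Heisenberg rotations `M₁, M₂`
and the involution `R`. -/
theorem gauss_picard_generated
    (G : Matrix (Fin 4) (Fin 4) ℂ)
    (hG : Gᴴ * Jmat * G = Jmat)
    (hint : ∀ j k, IsGaussInt (G j k)) :
    ∃ lam : ℂ, (lam = 1 ∨ lam = -1 ∨ lam = Complex.I ∨ lam = -Complex.I) ∧
      ∃ g ∈ Subgroup.closure
        {g : GL (Fin 4) ℂ | (g : Matrix (Fin 4) (Fin 4) ℂ) = Nmat₁ ∨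
          (g : Matrix (Fin 4) (Fin 4) ℂ) = Nmat₂ ∨
          (g : Matrix (Fin 4) (Fin 4) ℂ) = Mmat₁ ∨
          (g : Matrix (Fin 4) (Fin 4) ℂ) = Mmat₂ ∨
          (g : Matrix (Fin 4) (Fin 4) ℂ) = Rmat},
        (g : Matrix (Fin 4) (Fin 4) ℂ) = lam • G := by
  obtain ⟨n, hn⟩ := gi_normSq (hint 3 0)
  exact main_ind n G hG hint hn
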